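/- arXiv:1605.03683 — 10 statements merged into one kernel-verified Lean document; each statement's English description precedes it below -/
import Mathlib

section
/- There exists a unique ν ∈ (0,∞) satisfying ν·h(ν) − g(ν) = −μ; moreover this ν satisfies ν ≥ ζ₀ and h(ν) > 0. -/
/-- Mean value theorem on an interval of `[0,∞)`, with `h` the derivative of `g` on `(0,∞)`. -/
lemma exists_mul_eq_sub_of_hasDerivAt {g h : ℝ → ℝ} (hg_cont : ContinuousOn g (Set.Ici 0))
    (hg_deriv : ∀ x, 0 < x → HasDerivAt g (h x) x) {a b : ℝ} (ha : 0 ≤ a) (hab : a < b) :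
    ∃ c, a < c ∧ c < b ∧ h c * (b - a) = g b - g a := by
  obtain ⟨c, hc, hcd⟩ := exists_hasDerivAt_eq_slope g h hab
    (hg_cont.mono fun x hx => ha.trans hx.1) fun x hx => hg_deriv x (ha.trans_lt hx.1)
  refine ⟨c, hc.1, hc.2, ?_⟩
  rw [hcd, div_mul_cancel₀ _ (sub_pos.2 hab).ne']

/-- There is a unique `ν ∈ (0,∞)` with `ν·h(ν) − g(ν) = −μ`; moreover `ν ≥ ζ₀`
and `h(ν) > 0`. -/
theorem vwap_exists_unique_nu
(g h : ℝ → ℝ) (ζ₀ μ : ℝ)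
    (hg_cont : ContinuousOn g (Set.Ici 0))
    (hg0 : g 0 = 0)
    (hg_nonneg : ∀ x, 0 ≤ x → 0 ≤ g x)
    (hg_deriv : ∀ x, 0 < x → HasDerivAt g (h x) x)
    (hh_cont : ContinuousOn h (Set.Ioi 0))
    (hh_nonneg : ∀ x, 0 < x → 0 ≤ h x)
    (hζ₀ : 0 ≤ ζ₀)
    (hh_anti : ∀ a b, 0 < a → a ≤ b → b ≤ ζ₀ → h b ≤ h a)
    (hh_mono : ∀ a b, ζ₀ ≤ a → 0 < a → a < b → h a < h b)
    (hh_tendsto : Filter.Tendsto h Filter.atTop Filter.atTop)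
    (hμ : μ < 0) :
    ∃ ν : ℝ, 0 < ν ∧ ν * h ν - g ν = -μ ∧ ζ₀ ≤ ν ∧ 0 < h ν ∧
      ∀ ν' : ℝ, 0 < ν' → ν' * h ν' - g ν' = -μ → ν' = ν := by
  have hle : ∀ x, 0 < x → x ≤ ζ₀ → x * h x - g x ≤ 0 := by
    intro x hx hxζ
    obtain ⟨c, hc0, hcx, hc⟩ := exists_mul_eq_sub_of_hasDerivAt hg_cont hg_deriv le_rfl hx
    have := hh_anti c x hc0 hcx.le hxζ
    rw [hg0] at hc
    nlinarith
  have hgrow : ∀ a b, ζ₀ ≤ a → 0 < a → a < b →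
      a * h a - g a + a * (h b - h a) < b * h b - g b := by
    intro a b haζ ha hab
    obtain ⟨c, hac, hcb, hc⟩ := exists_mul_eq_sub_of_hasDerivAt hg_cont hg_deriv ha.le hab
    have := hh_mono c b (haζ.trans hac.le) (ha.trans hac) hcb
    nlinarith [mul_pos (sub_pos.2 hab) (sub_pos.2 this)]
  have hmono : ∀ a b, ζ₀ ≤ a → 0 < a → a < b → a * h a - g a < b * h b - g b := by
    intro a b haζ ha hab
    have := mul_pos ha (sub_pos.2 (hh_mono a b haζ ha hab))
    linarith [hgrow a b haζ ha hab]
  obtain ⟨p, hp0, hpζ, hp⟩ : ∃ p, 0 < p ∧ ζ₀ ≤ p ∧ p * h p - g p ≤ -μ := by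
    rcases hζ₀.lt_or_eq with hpos | rfl
    · exact ⟨ζ₀, hpos, le_rfl, by linarith [hle ζ₀ hpos le_rfl]⟩
    · have h1 := hh_nonneg 1 one_pos
      have hd : 0 < -μ / (h 1 + 1) := div_pos (by linarith) (by linarith)
      have hp0 : 0 < min 1 (-μ / (h 1 + 1)) := lt_min one_pos hd
      generalize hpdef : min 1 (-μ / (h 1 + 1)) = p at hp0
      have hp1 : p ≤ 1 := hpdef ▸ min_le_left _ _
      have hpμ : p * (h 1 + 1) ≤ -μ :=
        (le_div_iff₀ (by linarith)).1 (hpdef ▸ min_le_right _ _)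
      have hhp : h p ≤ h 1 := by
        rcases hp1.lt_or_eq with hlt | heq
        · exact (hh_mono p 1 hp0.le hp0 hlt).le
        · rw [heq]
      refine ⟨p, hp0, hp0.le, ?_⟩
      nlinarith [hg_nonneg p hp0.le, mul_le_mul_of_nonneg_left hhp hp0.le]
  obtain ⟨q, hpq, hq⟩ : ∃ q, p < q ∧ -μ ≤ q * h q - g q := by
    obtain ⟨q, hq, hpq⟩ := ((hh_tendsto.eventually_ge_atTop
      (h p + (-μ - (p * h p - g p)) / p)).and (Filter.eventually_gt_atTop p)).exists
    refine ⟨q, hpq, ?_⟩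
    have : (-μ - (p * h p - g p)) / p ≤ h q - h p := by linarith
    rw [div_le_iff₀ hp0] at this
    linarith [hgrow p q hpζ hp0 hpq]
  have hcont : ContinuousOn (fun x => x * h x - g x) (Set.Icc p q) :=
    (continuousOn_id.mul (hh_cont.mono fun x hx => hp0.trans_le hx.1)).sub
      (hg_cont.mono fun x hx => hp0.le.trans hx.1)
  obtain ⟨ν, hν, hνeq⟩ := intermediate_value_Icc hpq.le hcont ⟨hp, hq⟩
  have hν0 : 0 < ν := hp0.trans_le hν.1
  have hνζ : ζ₀ ≤ ν := hpζ.trans hν.1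
  replace hνeq : ν * h ν - g ν = -μ := hνeq
  refine ⟨ν, hν0, hνeq, hνζ, ?_, fun ν' hν'0 hν'eq => ?_⟩
  · exact pos_of_mul_pos_right (by linarith [hg_nonneg ν hν0.le]) hν0.le
  · have hν'ζ : ζ₀ ≤ ν' := by
      by_contra! hlt
      linarith [hle ν' hν'0 hlt.le]
    rcases lt_trichotomy ν' ν with hlt | heq | hlt
    · linarith [hmono ν' ν hν'ζ hν'0 hlt]
    · exact heq
    · linarith [hmono ν ν' hνζ hν0 hlt]
end

section
/- For every a ∈ [0,∞), a·h(ν) − g(a) ≤ ν·h(ν) − g(ν) = −μ; that is, ν maximizes the function a ↦ a·h(ν) − g(a) over [0,∞). -/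
/-- `ν` maximizes `a ↦ a·h(ν) − g(a)` over `[0,∞)`, with maximum value `−μ`. -/
theorem vwap_nu_maximizes
(g h : ℝ → ℝ) (ζ₀ μ : ℝ)
    (hg_cont : ContinuousOn g (Set.Ici 0))
    (hg0 : g 0 = 0)
    (hg_nonneg : ∀ x, 0 ≤ x → 0 ≤ g x)
    (hg_deriv : ∀ x, 0 < x → HasDerivAt g (h x) x)
    (hh_cont : ContinuousOn h (Set.Ioi 0))
    (hh_nonneg : ∀ x, 0 < x → 0 ≤ h x)
    (hζ₀ : 0 ≤ ζ₀)
    (hh_anti : ∀ a b, 0 < a → a ≤ b → b ≤ ζ₀ → h b ≤ h a)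
    (hh_mono : ∀ a b, ζ₀ ≤ a → 0 < a → a < b → h a < h b)
    (hh_tendsto : Filter.Tendsto h Filter.atTop Filter.atTop)
    (hμ : μ < 0)
(ν : ℝ) (hν_pos : 0 < ν) (hν_ge : ζ₀ ≤ ν)
    (hν_eq : ν * h ν - g ν = -μ) (hhν_pos : 0 < h ν) :
    ∀ a, 0 ≤ a → a * h ν - g a ≤ ν * h ν - g ν := by
  have mvt : ∀ x y, 0 ≤ x → x < y → ∃ c, x < c ∧ c < y ∧ h c * (y - x) = g y - g x := by
    intro x y hx hxy
    obtain ⟨c, ⟨hxc, hcy⟩, hc⟩ := exists_hasDerivAt_eq_slope g h hxy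
      (hg_cont.mono fun z hz => hx.trans hz.1) fun z hz => hg_deriv z (hx.trans_lt hz.1)
    exact ⟨c, hxc, hcy, by rw [hc, div_mul_cancel₀ _ (sub_pos.2 hxy).ne']⟩
  intro a ha
  by_contra! hlt
  rcases lt_trichotomy a ν with haν | rfl | hνa
  · rcases ha.eq_or_lt with rfl | ha0
    · linarith
    obtain ⟨c, hc0, hca, hc⟩ := mvt 0 a le_rfl ha0
    obtain ⟨d, had, hdν, hd⟩ := mvt a ν ha haν
    have hcν : h c < h ν := by
      by_contra! hle
      nlinarith
    have hνd : h ν < h d := by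
      by_contra! hle
      nlinarith
    have hdζ : d ≤ ζ₀ := by
      by_contra! hζd
      exact (hh_mono d ν hζd.le (ha0.trans had) hdν).not_gt hνd
    linarith [hh_anti c d hc0 (hca.trans had).le hdζ]
  · exact lt_irrefl _ hlt
  · obtain ⟨d, hνd, hda, hd⟩ := mvt ν a hν_pos.le hνa
    nlinarith [hh_mono ν d hν_ge hν_pos hνd]
end

section
/- For every a ≥ 0 and every y ≥ 0, the Hamilton–Jacobi–Bellman pointwise inequality holds: a·(1 − e^{−h(ν)·y}) + (μ − g(a))·(1 − e^{−h(ν)·y})/h(ν) ≤ 0; equivalently, a + (μ − g(a))·f(y) − a·f′(y) ≤ 0 where f(y) := (1 − e^{−h(ν)·y})/h(ν). -/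
/-- If `g' = h`, where `h` first decreases and then increases, the tangent line to `g` at a point
`ν` of the increasing branch with nonpositive intercept lies below `g` on `[0, ∞)`. -/
theorem tangent_le_of_antitone_then_monotone {g h : ℝ → ℝ} {ζ₀ ν : ℝ}
    (hg_cont : ContinuousOn g (Set.Ici 0)) (hg0 : g 0 = 0)
    (hg_deriv : ∀ x, 0 < x → HasDerivAt g (h x) x)
    (hh_anti : ∀ a b, 0 < a → a ≤ b → b ≤ ζ₀ → h b ≤ h a)
    (hh_mono : ∀ a b, ζ₀ ≤ a → 0 < a → a < b → h a < h b)
    (hν_pos : 0 < ν) (hν_ge : ζ₀ ≤ ν) (hν : 0 ≤ ν * h ν - g ν) {a : ℝ} (ha : 0 ≤ a) :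
    a * h ν - g a ≤ ν * h ν - g ν := by
  have mvt : ∀ s t, 0 ≤ s → s < t → ∃ c, s < c ∧ c < t ∧ g t - g s = h c * (t - s) := by
    intro s t hs hst
    obtain ⟨c, hc, hc'⟩ := exists_hasDerivAt_eq_slope g h hst
      (hg_cont.mono fun x hx => hs.trans hx.1) fun x hx => hg_deriv x (hs.trans_lt hx.1)
    exact ⟨c, hc.1, hc.2, by rw [hc', div_mul_cancel₀ _ (sub_pos.2 hst).ne']⟩
  rcases ha.eq_or_lt with rfl | ha0
  · simpa [hg0] using hν
  rcases lt_trichotomy a ν with hlt | rfl | hgt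
  · by_cases hle : h ν ≤ h a
    · have haζ : a ≤ ζ₀ := by
        by_contra! hc
        exact absurd (hh_mono a ν hc.le ha0 hlt) hle.not_gt
      obtain ⟨c, hc0, hca, hc⟩ := mvt 0 a le_rfl ha0
      have := hh_anti c a hc0 hca.le haζ
      rw [hg0] at hc
      nlinarith
    · obtain ⟨c, hac, hcν, hc⟩ := mvt a ν ha hlt
      have hcle : h c ≤ h ν := by
        rcases le_total c ζ₀ with hcζ | hcζ
        · exact (hh_anti a c ha0 hac.le hcζ).trans (not_le.1 hle).le
        · exact (hh_mono c ν hcζ (ha0.trans hac) hcν).le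
      nlinarith
  · rfl
  · obtain ⟨c, hνc, hca, hc⟩ := mvt ν a hν_pos.le hgt
    have := hh_mono ν c hν_ge hν_pos hνc
    nlinarith


/-- The pointwise HJB inequality:
`a·(1 − e^{−h(ν)y}) + (μ − g(a))·(1 − e^{−h(ν)y})/h(ν) ≤ 0` for `a, y ≥ 0`. -/
theorem vwap_hjb_inequality
(g h : ℝ → ℝ) (ζ₀ μ : ℝ)
    (hg_cont : ContinuousOn g (Set.Ici 0))
    (hg0 : g 0 = 0)
    (hg_nonneg : ∀ x, 0 ≤ x → 0 ≤ g x)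
    (hg_deriv : ∀ x, 0 < x → HasDerivAt g (h x) x)
    (hh_cont : ContinuousOn h (Set.Ioi 0))
    (hh_nonneg : ∀ x, 0 < x → 0 ≤ h x)
    (hζ₀ : 0 ≤ ζ₀)
    (hh_anti : ∀ a b, 0 < a → a ≤ b → b ≤ ζ₀ → h b ≤ h a)
    (hh_mono : ∀ a b, ζ₀ ≤ a → 0 < a → a < b → h a < h b)
    (hh_tendsto : Filter.Tendsto h Filter.atTop Filter.atTop)
    (hμ : μ < 0)
(ν : ℝ) (hν_pos : 0 < ν) (hν_ge : ζ₀ ≤ ν)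
    (hν_eq : ν * h ν - g ν = -μ) (hhν_pos : 0 < h ν) :
    ∀ a, 0 ≤ a → ∀ y, 0 ≤ y →
      a * (1 - Real.exp (-(h ν) * y)) +
        (μ - g a) * ((1 - Real.exp (-(h ν) * y)) / h ν) ≤ 0 := by
  intro a ha y hy
  have htan := tangent_le_of_antitone_then_monotone hg_cont hg0 hg_deriv hh_anti hh_mono hν_pos
    hν_ge (by linarith) ha
  have hexp : Real.exp (-(h ν) * y) ≤ 1 := Real.exp_le_one_iff.2 (by nlinarith)
  have hfactor : a * (1 - Real.exp (-(h ν) * y)) +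
      (μ - g a) * ((1 - Real.exp (-(h ν) * y)) / h ν) =
      (a * h ν + μ - g a) * ((1 - Real.exp (-(h ν) * y)) / h ν) := by
    field_simp
    ring
  rw [hfactor]
  exact mul_nonpos_of_nonpos_of_nonneg (by linarith) (div_nonneg (by linarith) hhν_pos.le)
end

section
/- Let θ > 0, x ≥ 0, and let a : [0,θ] → [0,∞) be bounded and Lebesgue measurable with ∫₀^θ a(s) ds ≤ x. Define y(τ) := x − ∫₀^τ a(s) ds, p(τ) := exp(μτ − ∫₀^τ g(a(s)) ds), and f(y) := (1 − e^{−h(ν)·y})/h(ν). Then the function M(τ) := ∫₀^τ a(s) p(s) ds + p(τ)·f(y(τ)) is non-increasing on [0,θ]. -/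
open MeasureTheory Set in
/-- The composition of a Lipschitz function with an absolutely continuous function is absolutely
continuous. -/
theorem LipschitzOnWith.comp_absolutelyContinuousOnInterval {X Y : Type*}
    [PseudoMetricSpace X] [PseudoMetricSpace Y] {K : NNReal} {φ : X → Y} {f : ℝ → X} {a b : ℝ}
    (hφ : LipschitzOnWith K φ (f '' uIcc a b)) (hf : AbsolutelyContinuousOnInterval f a b) :
    AbsolutelyContinuousOnInterval (fun x => φ (f x)) a b := by
  rw [absolutelyContinuousOnInterval_iff] at hf ⊢
  intro ε hε
  obtain ⟨δ, hδ, H⟩ := hf (ε / (K + 1)) (by positivity)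
  refine ⟨δ, hδ, fun E hE hlen => ?_⟩
  have hsum := H E hE hlen
  rw [lt_div_iff₀ (by positivity)] at hsum
  refine lt_of_le_of_lt ?_ hsum
  rw [Finset.sum_mul]
  refine Finset.sum_le_sum fun i hi => ?_
  obtain ⟨h₁, h₂⟩ := hE.1 i hi
  have hd := hφ.dist_le_mul _ (mem_image_of_mem f h₁) _ (mem_image_of_mem f h₂)
  nlinarith [dist_nonneg (x := f (E.2 i).1) (y := f (E.2 i).2)]

open MeasureTheory Set in
theorem AbsolutelyContinuousOnInterval.exp {f : ℝ → ℝ} {a b : ℝ}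
    (hf : AbsolutelyContinuousOnInterval f a b) :
    AbsolutelyContinuousOnInterval (fun x => Real.exp (f x)) a b := by
  obtain ⟨C, hC⟩ := hf.exists_bound
  obtain ⟨K, hK⟩ := (Real.contDiff_exp (n := 1)).contDiffOn.exists_lipschitzOnWith (by decide)
    (convex_Icc (-C) C) isCompact_Icc
  refine LipschitzOnWith.comp_absolutelyContinuousOnInterval (hK.mono ?_) hf
  rintro _ ⟨x, hx, rfl⟩
  exact abs_le.1 (hC x hx)

open MeasureTheory Set in
/-- An absolutely continuous function whose derivative is almost everywhere nonpositive is
antitone. -/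
theorem AbsolutelyContinuousOnInterval.antitoneOn_of_ae_deriv_nonpos {f : ℝ → ℝ} {a b : ℝ}
    (hab : a ≤ b) (hf : AbsolutelyContinuousOnInterval f a b)
    (hf' : ∀ᵐ x, x ∈ Icc a b → deriv f x ≤ 0) : AntitoneOn f (Icc a b) := by
  intro s hs t ht hst
  have hsub : Icc s t ⊆ Icc a b := Icc_subset_Icc hs.1 ht.2
  have hac : AbsolutelyContinuousOnInterval f s t :=
    hf.mono (by rwa [uIcc_of_le hst, uIcc_of_le hab])
  have hint : 0 ≤ ∫ x in s..t, -deriv f x := by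
    refine intervalIntegral.integral_nonneg_of_ae_restrict hst ?_
    filter_upwards [ae_restrict_of_ae hf', ae_restrict_mem measurableSet_Icc] with x hx hmem
    simpa using hx (hsub hmem)
  rw [intervalIntegral.integral_neg, hac.integral_deriv_eq_sub] at hint
  linarith

open Set in
/-- A function that is concave on `[0, c]` and convex on `[c, ∞)` lies above its tangent at
`ν ≥ c` as soon as it does so at `0`. -/
theorem tangent_le_of_antitone_of_monotone_deriv {g h : ℝ → ℝ} {c ν : ℝ}
    (hg_cont : ContinuousOn g (Ici 0))
    (hg_deriv : ∀ x, 0 < x → HasDerivAt g (h x) x) (hc : 0 ≤ c)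
    (hh_anti : ∀ a b, 0 < a → a ≤ b → b ≤ c → h b ≤ h a)
    (hh_mono : ∀ a b, c ≤ a → 0 < a → a < b → h a < h b)
    (hν_pos : 0 < ν) (hν : c ≤ ν) (h0 : g ν - ν * h ν ≤ g 0) {z : ℝ} (hz : 0 ≤ z) :
    g ν + h ν * (z - ν) ≤ g z := by
  set φ : ℝ → ℝ := fun z => g z - h ν * z with hφ
  have hφ_cont : ContinuousOn φ (Ici 0) := hg_cont.sub (by fun_prop)
  have hφ_deriv : ∀ x, 0 < x → HasDerivAt φ (h x - h ν) x := fun x hx => by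
    simpa using (hg_deriv x hx).fun_sub ((hasDerivAt_id x).const_mul (h ν))
  have above : ∀ z, c ≤ z → φ ν ≤ φ z := by
    intro z hz
    rcases le_total ν z with hνz | hzν
    · refine monotoneOn_of_deriv_nonneg (convex_Ici ν)
        (hφ_cont.mono (Ici_subset_Ici.2 hν_pos.le)) ?_ ?_ self_mem_Ici hνz hνz
      · intro x hx
        rw [interior_Ici] at hx
        exact (hφ_deriv x (hν_pos.trans hx)).differentiableAt.differentiableWithinAt
      · intro x hx
        rw [interior_Ici] at hx
        rw [(hφ_deriv x (hν_pos.trans hx)).deriv]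
        linarith [hh_mono ν x hν hν_pos hx]
    · refine antitoneOn_of_deriv_nonpos (convex_Icc c ν)
        (hφ_cont.mono fun x hx => hc.trans hx.1) ?_ ?_ ⟨hz, hzν⟩ ⟨hν, le_rfl⟩ hzν
      · intro x hx
        rw [interior_Icc] at hx
        exact (hφ_deriv x (hc.trans_lt hx.1)).differentiableAt.differentiableWithinAt
      · intro x hx
        rw [interior_Icc] at hx
        rw [(hφ_deriv x (hc.trans_lt hx.1)).deriv]
        linarith [hh_mono x ν hx.1.le (hc.trans_lt hx.1) hx.2]
  have key : φ ν ≤ φ z := by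
    rcases le_total c z with hcz | hzc
    · exact above z hcz
    · have hconc : ConcaveOn ℝ (Icc 0 c) φ := by
        refine AntitoneOn.concaveOn_of_deriv (convex_Icc 0 c)
          (hφ_cont.mono fun x hx => hx.1) ?_ ?_
        · intro x hx
          rw [interior_Icc] at hx
          exact (hφ_deriv x hx.1).differentiableAt.differentiableWithinAt
        · intro x hx y hy hxy
          rw [interior_Icc] at hx hy
          rw [(hφ_deriv x hx.1).deriv, (hφ_deriv y hy.1).deriv]
          linarith [hh_anti x y hx.1 hxy hy.2.le]
      refine le_trans (le_min ?_ (above c le_rfl))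
        (hconc.min_le_of_mem_Icc ⟨le_rfl, hc⟩ ⟨hc, le_rfl⟩ ⟨hz, hzc⟩)
      simp only [hφ]
      linarith
  simp only [hφ] at key
  linarith

open MeasureTheory Set in
theorem intervalIntegrable_comp_of_bounded {φ a : ℝ → ℝ} {θ C : ℝ} (hθ : 0 ≤ θ)
    (hφ : ContinuousOn φ (Ici 0)) (ha : Measurable a)
    (hC : ∀ s ∈ Icc 0 θ, a s ≤ C) (h0 : ∀ s ∈ Icc 0 θ, 0 ≤ a s) :
    IntervalIntegrable (fun s => φ (a s)) volume 0 θ := by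
  obtain ⟨B, hB⟩ := (isCompact_Icc (a := (0 : ℝ)) (b := C)).exists_bound_of_continuousOn
    (hφ.mono fun x hx => hx.1)
  have hcont : Continuous fun z => φ (max z 0) :=
    hφ.comp_continuous (by fun_prop) fun z => le_max_right z 0
  rw [intervalIntegrable_iff_integrableOn_Icc_of_le hθ]
  have hmeas : AEStronglyMeasurable (fun s => φ (a s)) (volume.restrict (Icc 0 θ)) := by
    refine (hcont.measurable.comp ha).aestronglyMeasurable.congr ?_
    filter_upwards [ae_restrict_mem measurableSet_Icc] with s hs
    simp [max_eq_left (h0 s hs)]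
  refine Integrable.of_bound hmeas B ?_
  filter_upwards [ae_restrict_mem measurableSet_Icc] with s hs
  exact hB _ ⟨h0 s hs, hC s hs⟩


/-- The verification martingale
`M(τ) = ∫₀^τ a(s)p(s) ds + p(τ)·f(y(τ))` is non-increasing on `[0,θ]`. -/
theorem vwap_verification_antitone
(g h : ℝ → ℝ) (ζ₀ μ : ℝ)
    (hg_cont : ContinuousOn g (Set.Ici 0))
    (hg0 : g 0 = 0)
    (hg_nonneg : ∀ x, 0 ≤ x → 0 ≤ g x)
    (hg_deriv : ∀ x, 0 < x → HasDerivAt g (h x) x)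
    (hh_cont : ContinuousOn h (Set.Ioi 0))
    (hh_nonneg : ∀ x, 0 < x → 0 ≤ h x)
    (hζ₀ : 0 ≤ ζ₀)
    (hh_anti : ∀ a b, 0 < a → a ≤ b → b ≤ ζ₀ → h b ≤ h a)
    (hh_mono : ∀ a b, ζ₀ ≤ a → 0 < a → a < b → h a < h b)
    (hh_tendsto : Filter.Tendsto h Filter.atTop Filter.atTop)
    (hμ : μ < 0)
(ν : ℝ) (hν_pos : 0 < ν) (hν_ge : ζ₀ ≤ ν)
    (hν_eq : ν * h ν - g ν = -μ) (hhν_pos : 0 < h ν)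
    (θ x : ℝ) (hθ : 0 < θ) (hx : 0 ≤ x)
    (a : ℝ → ℝ) (ha_meas : Measurable a)
    (ha_bdd : ∃ C, ∀ s ∈ Set.Icc 0 θ, a s ≤ C)
    (ha_nonneg : ∀ s ∈ Set.Icc 0 θ, 0 ≤ a s)
    (ha_int : (∫ s in (0:ℝ)..θ, a s) ≤ x) :
    AntitoneOn (fun τ =>
      (∫ s in (0:ℝ)..τ, a s * Real.exp (μ * s - ∫ u in (0:ℝ)..s, g (a u))) +
        Real.exp (μ * τ - ∫ u in (0:ℝ)..τ, g (a u)) *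
          ((1 - Real.exp (-(h ν) * (x - ∫ s in (0:ℝ)..τ, a s))) / h ν))
      (Set.Icc 0 θ) := by
  obtain ⟨C, hC⟩ := ha_bdd
  set κ := h ν
  have tangent : ∀ z, 0 ≤ z → κ * z + μ - g z ≤ 0 := fun z hz => by
    linarith [tangent_le_of_antitone_of_monotone_deriv hg_cont hg_deriv hζ₀ hh_anti hh_mono
      hν_pos hν_ge (by rw [hg0]; linarith) hz]
  have iY : IntervalIntegrable a MeasureTheory.volume 0 θ :=
    intervalIntegrable_comp_of_bounded (φ := id) hθ.le continuousOn_id ha_meas hC ha_nonneg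
  have iG : IntervalIntegrable (fun s => g (a s)) MeasureTheory.volume 0 θ :=
    intervalIntegrable_comp_of_bounded hθ.le hg_cont ha_meas hC ha_nonneg
  have hmem : (0 : ℝ) ∈ Set.uIcc 0 θ := Set.left_mem_uIcc
  have acY := iY.absolutelyContinuousOnInterval_intervalIntegral hmem
  have acG := iG.absolutelyContinuousOnInterval_intervalIntegral hmem
  set Y : ℝ → ℝ := fun τ => ∫ s in (0:ℝ)..τ, a s
  set G : ℝ → ℝ := fun τ => ∫ s in (0:ℝ)..τ, g (a s)
  have acp : AbsolutelyContinuousOnInterval (fun τ => Real.exp (μ * τ - G τ)) 0 θ :=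
    (AbsolutelyContinuousOnInterval.sub
      (f := fun τ => μ * τ) (ContDiff.contDiffOn (by fun_prop)).absolutelyContinuousOnInterval
      acG).exp
  have iP : IntervalIntegrable (fun s => a s * Real.exp (μ * s - G s))
      MeasureTheory.volume 0 θ := iY.mul_continuousOn acp.continuousOn
  have acP := iP.absolutelyContinuousOnInterval_intervalIntegral hmem
  have const_ac (c : ℝ) : AbsolutelyContinuousOnInterval (fun _ : ℝ => c) 0 θ :=
    (contDiff_const (n := 1)).contDiffOn.absolutelyContinuousOnInterval
  have acE : AbsolutelyContinuousOnInterval (fun τ => Real.exp (-κ * (x - Y τ))) 0 θ :=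
    (((const_ac x).sub acY).const_mul (-κ)).exp
  have acf : AbsolutelyContinuousOnInterval
      (fun τ => (1 - Real.exp (-κ * (x - Y τ))) / κ) 0 θ := by
    simpa only [div_eq_inv_mul, Pi.sub_apply] using ((const_ac 1).sub acE).const_mul κ⁻¹
  refine AbsolutelyContinuousOnInterval.antitoneOn_of_ae_deriv_nonpos hθ.le
    (acP.add (acp.mul acf)) ?_
  filter_upwards [iY.ae_hasDerivAt_integral, iG.ae_hasDerivAt_integral,
    iP.ae_hasDerivAt_integral] with τ hYτ hGτ hPτ hτ
  have hτ' : τ ∈ Set.uIcc 0 θ := by rwa [Set.uIcc_of_le hθ.le]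
  have dY : HasDerivAt Y (a τ) τ := hYτ hτ' 0 hmem
  have dG : HasDerivAt G (g (a τ)) τ := hGτ hτ' 0 hmem
  have dP := hPτ hτ' 0 hmem
  have dp := (((hasDerivAt_id τ).const_mul μ).fun_sub dG).exp
  have df := (((((dY.const_sub x).const_mul (-κ)).exp).const_sub 1).div_const κ)
  refine (dP.add (dp.mul df)).deriv.trans_le ?_
  have hYx : Y τ ≤ x := by
    refine le_trans ?_ ha_int
    refine intervalIntegral.integral_mono_interval le_rfl hτ.1 hτ.2 ?_ iY
    filter_upwards [MeasureTheory.ae_restrict_mem measurableSet_Ioc] with s hs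
    exact ha_nonneg s ⟨hs.1.le, hs.2⟩
  have hE : Real.exp (-κ * (x - Y τ)) ≤ 1 := by
    rw [Real.exp_le_one_iff]
    nlinarith
  have hprod : Real.exp (μ * τ - G τ) * ((1 - Real.exp (-κ * (x - Y τ))) / κ) *
      (κ * a τ + μ - g (a τ)) ≤ 0 :=
    mul_nonpos_of_nonneg_of_nonpos
      (mul_nonneg (Real.exp_pos _).le (div_nonneg (by linarith) hhν_pos.le))
      (tangent _ (ha_nonneg τ hτ))
  refine le_of_eq_of_le ?_ hprod
  simp only [id]
  field_simp
  ring
end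

section
/- There exists a unique ν̂ ∈ (0,1) satisfying ν̂·ĥ(ν̂) − ĝ(ν̂) = −μ; moreover this ν̂ satisfies ν̂ ≥ ζ₀ and ĥ(ν̂) > 0. -/
/-- There is a unique `ν̂ ∈ (0,1)` with `ν̂·ĥ(ν̂) − ĝ(ν̂) = −μ`; moreover
`ν̂ ≥ ζ₀` and `ĥ(ν̂) > 0`. -/
theorem vwap_hat_exists_unique_nu
(gh hh : ℝ → ℝ) (ζ₀ μ : ℝ)
    (hg_cont : ContinuousOn gh (Set.Ico 0 1))
    (hg0 : gh 0 = 0)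
    (hg_nonneg : ∀ b, 0 ≤ b → b < 1 → 0 ≤ gh b)
    (hg_deriv : ∀ b, 0 < b → b < 1 → HasDerivAt gh (hh b) b)
    (hh_cont : ContinuousOn hh (Set.Ioo 0 1))
    (hh_nonneg : ∀ b, 0 < b → b < 1 → 0 ≤ hh b)
    (hζ₀ : 0 ≤ ζ₀) (hζ₀1 : ζ₀ < 1)
    (hh_anti : ∀ b₁ b₂, 0 < b₁ → b₁ ≤ b₂ → b₂ ≤ ζ₀ → hh b₂ ≤ hh b₁)
    (hh_mono : ∀ b₁ b₂, ζ₀ ≤ b₁ → 0 < b₁ → b₁ < b₂ → b₂ < 1 → hh b₁ < hh b₂)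
    (hh_tendsto : Filter.Tendsto hh (nhdsWithin 1 (Set.Iio 1)) Filter.atTop)
    (hμ : μ < 0) :
    ∃ νh : ℝ, 0 < νh ∧ νh < 1 ∧ νh * hh νh - gh νh = -μ ∧ ζ₀ ≤ νh ∧ 0 < hh νh ∧
      ∀ νh' : ℝ, 0 < νh' → νh' < 1 → νh' * hh νh' - gh νh' = -μ → νh' = νh := by
  have slope : ∀ a b, 0 ≤ a → a < b → b < 1 →
      ∃ c, a < c ∧ c < b ∧ gh b - gh a = hh c * (b - a) := by
    intro a b ha hab hb
    obtain ⟨c, ⟨hac, hcb⟩, hc⟩ := exists_hasDerivAt_eq_slope gh hh hab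
      (hg_cont.mono fun x hx => ⟨ha.trans hx.1, hx.2.trans_lt hb⟩)
      fun x hx => hg_deriv x (ha.trans_lt hx.1) (hx.2.trans hb)
    refine ⟨c, hac, hcb, ?_⟩
    rw [hc, div_mul_cancel₀ _ (sub_pos.2 hab).ne']
  have nonpos : ∀ b, 0 < b → b ≤ ζ₀ → b * hh b - gh b ≤ 0 := by
    intro b hb hbζ
    obtain ⟨c, hc, hcb, h⟩ := slope 0 b le_rfl hb (hbζ.trans_lt hζ₀1)
    have := mul_le_mul_of_nonneg_right (hh_anti c b hc hcb.le hbζ) hb.le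
    linarith
  have tangent : ∀ a b, ζ₀ ≤ a → 0 < a → a < b → b < 1 →
      a * hh b - gh a < b * hh b - gh b := by
    intro a b haζ ha hab hb
    obtain ⟨c, hac, hcb, h⟩ := slope a b ha.le hab hb
    have := mul_lt_mul_of_pos_right
      (hh_mono c b (haζ.trans hac.le) (ha.trans hac) hcb hb) (sub_pos.2 hab)
    linarith
  have strict : ∀ a b, ζ₀ ≤ a → 0 < a → a < b → b < 1 →
      a * hh a - gh a < b * hh b - gh b := by
    intro a b haζ ha hab hb
    have := mul_lt_mul_of_pos_left (hh_mono a b haζ ha hab hb) ha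
    linarith [tangent a b haζ ha hab hb]
  obtain ⟨a, haζ, ha, ha1, hFa⟩ :
      ∃ a, ζ₀ ≤ a ∧ 0 < a ∧ a < 1 ∧ a * hh a - gh a < -μ := by
    rcases hζ₀.eq_or_lt with rfl | hpos
    · have hM : 0 ≤ hh (1 / 2) := hh_nonneg _ (by norm_num) (by norm_num)
      have hε : 0 < -μ / (hh (1 / 2) + 1) := div_pos (by linarith) (by linarith)
      obtain ⟨a, ha, hlt⟩ := exists_between (lt_min (by norm_num : (0 : ℝ) < 1 / 2) hε)
      obtain ⟨ha2, haε⟩ := lt_min_iff.1 hlt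
      refine ⟨a, ha.le, ha, by linarith, ?_⟩
      rw [lt_div_iff₀ (by linarith)] at haε
      have := mul_lt_mul_of_pos_left
        (hh_mono a (1 / 2) ha.le ha ha2 (by norm_num)) ha
      linarith [hg_nonneg a ha.le (by linarith)]
    · exact ⟨ζ₀, le_rfl, hpos, hζ₀1, by linarith [nonpos ζ₀ hpos le_rfl]⟩
  obtain ⟨b, hhb, hab, hb1⟩ : ∃ b, (gh a - μ) / a < hh b ∧ a < b ∧ b < 1 := by
    obtain ⟨b, hb, hab⟩ := ((hh_tendsto.eventually_gt_atTop _).and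
      (Ioo_mem_nhdsLT ha1)).exists
    exact ⟨b, hb, hab.1, hab.2⟩
  have hFb : -μ < b * hh b - gh b := by
    rw [div_lt_iff₀ ha] at hhb
    linarith [tangent a b haζ ha hab hb1]
  have hcont : ContinuousOn (fun x => x * hh x - gh x) (Set.Icc a b) :=
    (continuousOn_id.mul (hh_cont.mono fun x hx =>
      ⟨ha.trans_le hx.1, hx.2.trans_lt hb1⟩)).sub
      (hg_cont.mono fun x hx => ⟨ha.le.trans hx.1, hx.2.trans_lt hb1⟩)
  obtain ⟨ν, ⟨haν, hνb⟩, hν⟩ := intermediate_value_Icc hab.le hcont ⟨hFa.le, hFb.le⟩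
  have hν0 : 0 < ν := ha.trans_le haν
  have hν1 : ν < 1 := hνb.trans_lt hb1
  have hνζ : ζ₀ ≤ ν := haζ.trans haν
  dsimp only at hν
  refine ⟨ν, hν0, hν1, hν, hνζ, ?_, fun ν' h0 h1 h => ?_⟩
  · refine pos_of_mul_pos_right (a := ν) ?_ hν0.le
    linarith [hg_nonneg ν hν0.le hν1]
  · have hζ' : ζ₀ ≤ ν' := by
      by_contra! hlt
      linarith [nonpos ν' h0 hlt.le]
    rcases lt_trichotomy ν' ν with hlt | heq | hgt
    · linarith [strict ν' ν hζ' h0 hlt hν1]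
    · exact heq
    · linarith [strict ν ν' hνζ hν0 hgt h1]
end

section
/- For every b ∈ [0,1), b·ĥ(ν̂) − ĝ(b) ≤ ν̂·ĥ(ν̂) − ĝ(ν̂) = −μ; that is, ν̂ maximizes the function b ↦ b·ĥ(ν̂) − ĝ(b) over [0,1). -/
/-- `ν̂` maximizes `b ↦ b·ĥ(ν̂) − ĝ(b)` over `[0,1)`, with maximum `−μ`. -/
theorem vwap_hat_nu_maximizes
(gh hh : ℝ → ℝ) (ζ₀ μ : ℝ)
    (hg_cont : ContinuousOn gh (Set.Ico 0 1))
    (hg0 : gh 0 = 0)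
    (hg_nonneg : ∀ b, 0 ≤ b → b < 1 → 0 ≤ gh b)
    (hg_deriv : ∀ b, 0 < b → b < 1 → HasDerivAt gh (hh b) b)
    (hh_cont : ContinuousOn hh (Set.Ioo 0 1))
    (hh_nonneg : ∀ b, 0 < b → b < 1 → 0 ≤ hh b)
    (hζ₀ : 0 ≤ ζ₀) (hζ₀1 : ζ₀ < 1)
    (hh_anti : ∀ b₁ b₂, 0 < b₁ → b₁ ≤ b₂ → b₂ ≤ ζ₀ → hh b₂ ≤ hh b₁)
    (hh_mono : ∀ b₁ b₂, ζ₀ ≤ b₁ → 0 < b₁ → b₁ < b₂ → b₂ < 1 → hh b₁ < hh b₂)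
    (hh_tendsto : Filter.Tendsto hh (nhdsWithin 1 (Set.Iio 1)) Filter.atTop)
    (hμ : μ < 0)
(νh : ℝ) (hνh_pos : 0 < νh) (hνh_lt : νh < 1) (hνh_ge : ζ₀ ≤ νh)
    (hνh_eq : νh * hh νh - gh νh = -μ) (hhνh_pos : 0 < hh νh) :
    ∀ b, 0 ≤ b → b < 1 → b * hh νh - gh b ≤ νh * hh νh - gh νh := by
  intro b hb0 hb1
  have mean_value : ∀ a c, 0 ≤ a → a < c → c < 1 →
      ∃ x ∈ Set.Ioo a c, gh c - gh a = hh x * (c - a) := by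
    intro a c ha hac hc
    obtain ⟨x, hx, hslope⟩ := exists_hasDerivAt_eq_slope gh hh hac
      (hg_cont.mono fun y hy => ⟨ha.trans hy.1, hy.2.trans_lt hc⟩)
      fun y hy => hg_deriv y (ha.trans_lt hy.1) (hy.2.trans hc)
    refine ⟨x, hx, ?_⟩
    rw [hslope, div_mul_cancel₀ _ (sub_pos.2 hac).ne']
  rcases hb0.eq_or_lt with rfl | hb_pos
  · rw [hg0]
    linarith
  rcases lt_trichotomy b νh with hlt | rfl | hgt
  · rcases le_or_gt (hh b) (hh νh) with hle | hgt
    · obtain ⟨x, ⟨hbx, hxν⟩, hx⟩ := mean_value b νh hb0 hlt hνh_lt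
      have hhx : hh x ≤ hh νh := by
        rcases le_total x ζ₀ with hxζ | hζx
        · exact (hh_anti b x hb_pos hbx.le hxζ).trans hle
        · exact (hh_mono x νh hζx (hb_pos.trans hbx) hxν hνh_lt).le
      nlinarith [mul_le_mul_of_nonneg_right hhx (sub_pos.2 hlt).le]
    · have hbζ : b ≤ ζ₀ := by
        by_contra! hζb
        exact (hh_mono b νh hζb.le hb_pos hlt hνh_lt).not_gt hgt
      obtain ⟨x, ⟨hx0, hxb⟩, hx⟩ := mean_value 0 b le_rfl hb_pos hb1
      have hhx : hh νh ≤ hh x := hgt.le.trans (hh_anti x b hx0 hxb.le hbζ)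
      rw [hg0, sub_zero, sub_zero] at hx
      nlinarith [mul_le_mul_of_nonneg_right hhx hb0]
  · exact le_rfl
  · obtain ⟨x, ⟨hνx, hxb⟩, hx⟩ := mean_value νh b hνh_pos.le hgt hb1
    have hhx : hh νh ≤ hh x := (hh_mono νh x hνh_ge hνh_pos hνx (hxb.trans hb1)).le
    nlinarith [mul_le_mul_of_nonneg_right hhx (sub_pos.2 hgt).le]
end

section
/- Define G : [0,∞) → ℝ by G(a) := (1+a)·ĝ(a/(1+a)) − μ·a. Then G(0) = 0, G is continuously differentiable on (0,∞) with G′(a) = ĝ(b) + (1−b)·ĥ(b) − μ where b := a/(1+a), and for ν := ν̂/(1−ν̂) one has G′(ν) = ĥ(ν̂) and ν·G′(ν) − G(ν) = −μ. (Thus the self-exciting-volume problem of Theorem 2 transforms into the setting of Theorem 1 with impact function G.) -/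
/-- The transformed impact function `G(a) = (1+a)·ĝ(a/(1+a)) − μ·a` satisfies
`G(0) = 0`, is continuously differentiable on `(0,∞)` with derivative
`G′(a) = ĝ(b) + (1−b)·ĥ(b) − μ` for `b = a/(1+a)`, and for `ν = ν̂/(1−ν̂)`
one has `G′(ν) = ĥ(ν̂)` and `ν·G′(ν) − G(ν) = −μ`. -/
theorem vwap_hat_transformed_impact
(gh hh : ℝ → ℝ) (ζ₀ μ : ℝ)
    (hg_cont : ContinuousOn gh (Set.Ico 0 1))
    (hg0 : gh 0 = 0)
    (hg_nonneg : ∀ b, 0 ≤ b → b < 1 → 0 ≤ gh b)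
    (hg_deriv : ∀ b, 0 < b → b < 1 → HasDerivAt gh (hh b) b)
    (hh_cont : ContinuousOn hh (Set.Ioo 0 1))
    (hh_nonneg : ∀ b, 0 < b → b < 1 → 0 ≤ hh b)
    (hζ₀ : 0 ≤ ζ₀) (hζ₀1 : ζ₀ < 1)
    (hh_anti : ∀ b₁ b₂, 0 < b₁ → b₁ ≤ b₂ → b₂ ≤ ζ₀ → hh b₂ ≤ hh b₁)
    (hh_mono : ∀ b₁ b₂, ζ₀ ≤ b₁ → 0 < b₁ → b₁ < b₂ → b₂ < 1 → hh b₁ < hh b₂)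
    (hh_tendsto : Filter.Tendsto hh (nhdsWithin 1 (Set.Iio 1)) Filter.atTop)
    (hμ : μ < 0)
(νh : ℝ) (hνh_pos : 0 < νh) (hνh_lt : νh < 1) (hνh_ge : ζ₀ ≤ νh)
    (hνh_eq : νh * hh νh - gh νh = -μ) (hhνh_pos : 0 < hh νh) :
    (fun a : ℝ => (1 + a) * gh (a / (1 + a)) - μ * a) 0 = 0 ∧
    (∀ a : ℝ, 0 < a →
      HasDerivAt (fun a : ℝ => (1 + a) * gh (a / (1 + a)) - μ * a)
        (gh (a / (1 + a)) + (1 - a / (1 + a)) * hh (a / (1 + a)) - μ) a) ∧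
    ContinuousOn
      (fun a : ℝ => gh (a / (1 + a)) + (1 - a / (1 + a)) * hh (a / (1 + a)) - μ)
      (Set.Ioi 0) ∧
    (gh (νh / (1 - νh) / (1 + νh / (1 - νh))) +
        (1 - νh / (1 - νh) / (1 + νh / (1 - νh))) *
          hh (νh / (1 - νh) / (1 + νh / (1 - νh))) - μ = hh νh) ∧
    (νh / (1 - νh) * (gh (νh / (1 - νh) / (1 + νh / (1 - νh))) +
        (1 - νh / (1 - νh) / (1 + νh / (1 - νh))) *
          hh (νh / (1 - νh) / (1 + νh / (1 - νh))) - μ) -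
      ((1 + νh / (1 - νh)) * gh (νh / (1 - νh) / (1 + νh / (1 - νh))) -
        μ * (νh / (1 - νh))) = -μ) := by
  have hb_cont : ContinuousOn (fun a : ℝ => a / (1 + a)) (Set.Ioi 0) :=
    continuousOn_id.div (continuousOn_const.add continuousOn_id)
      fun a (ha : 0 < a) => (add_pos one_pos ha).ne'
  have hb_mem : ∀ a : ℝ, 0 < a → a / (1 + a) ∈ Set.Ioo (0 : ℝ) 1 := fun a ha =>
    ⟨by positivity, (div_lt_one (by positivity)).2 (by linarith)⟩
  have hb_νh : νh / (1 - νh) / (1 + νh / (1 - νh)) = νh := by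
    have h : 1 - νh ≠ 0 := (sub_pos.2 hνh_lt).ne'
    have h₁ : 1 + νh / (1 - νh) = 1 / (1 - νh) := by
      field_simp
      ring
    rw [h₁]
    field_simp
  have hG' : gh νh + (1 - νh) * hh νh - μ = hh νh := by linear_combination -hνh_eq
  refine ⟨by simp [hg0], fun a ha => ?_, ?_, ?_, ?_⟩
  · have hne : (1 + a) ≠ 0 := by positivity
    have hs : HasDerivAt (fun x : ℝ => 1 + x) 1 a := (hasDerivAt_id a).const_add 1
    have hb := (hasDerivAt_id a).fun_div hs hne
    have hgb := (hg_deriv _ (hb_mem a ha).1 (hb_mem a ha).2).comp a hb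
    refine ((hs.fun_mul hgb).fun_sub ((hasDerivAt_id a).const_mul μ)).congr_deriv ?_
    simp only [Function.comp_apply, id]
    field_simp
  · have hgh : ContinuousOn gh (Set.Ioo 0 1) := hg_cont.mono Set.Ioo_subset_Ico_self
    exact ((hgh.comp hb_cont hb_mem).add
      ((continuousOn_const.sub hb_cont).mul (hh_cont.comp hb_cont hb_mem))).sub
        continuousOn_const
  · rw [hb_νh, hG']
  · rw [hb_νh, hG']
    have h : 1 - νh ≠ 0 := (sub_pos.2 hνh_lt).ne'
    field_simp
    linear_combination hνh_eq
end

section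
/- For every a ≥ 0 and every y ≥ 0, the Hamilton–Jacobi–Bellman pointwise inequality for the self-exciting-volume problem holds: a·(1 − e^{−ĥ(ν̂)·y}) + (1+a)·(μ − ĝ(a/(1+a)))·(1 − e^{−ĥ(ν̂)·y})/ĥ(ν̂) ≤ 0; equivalently, a + (1+a)(μ − ĝ(a/(1+a)))·f̂(y) − a·f̂′(y) ≤ 0 where f̂(y) := (1 − e^{−ĥ(ν̂)·y})/ĥ(ν̂). -/
/-- Mean value theorem for a function on `[0, 1)` that is differentiable only in the interior. -/
theorem exists_deriv_mul_sub_eq_sub {g h : ℝ → ℝ} (hg : ContinuousOn g (Set.Ico 0 1))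
    (hd : ∀ b, 0 < b → b < 1 → HasDerivAt g (h b) b) {x y : ℝ} (hx : 0 ≤ x) (hxy : x < y)
    (hy : y < 1) : ∃ c, x < c ∧ c < y ∧ h c * (y - x) = g y - g x := by
  obtain ⟨c, ⟨hxc, hcy⟩, hc⟩ := exists_hasDerivAt_eq_slope g h hxy
    (hg.mono fun z hz => ⟨hx.trans hz.1, hz.2.trans_lt hy⟩)
    fun z hz => hd z (hx.trans_lt hz.1) (hz.2.trans hy)
  exact ⟨c, hxc, hcy, by rw [hc, div_mul_cancel₀ _ (sub_pos.2 hxy).ne']⟩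

/-- If `h = g'` decreases and then increases on `(0, 1)`, and the tangent line to `g` at a point
`ν` of the increasing branch is nonpositive at `0`, where `g` vanishes, then that line lies
below the graph of `g`. -/
theorem tangent_le_of_antitone_then_monotone_s16 {g h : ℝ → ℝ} {ζ ν b : ℝ}
    (hg : ContinuousOn g (Set.Ico 0 1)) (hg0 : g 0 = 0)
    (hd : ∀ b, 0 < b → b < 1 → HasDerivAt g (h b) b)
    (hanti : ∀ b₁ b₂, 0 < b₁ → b₁ ≤ b₂ → b₂ ≤ ζ → h b₂ ≤ h b₁)
    (hmono : ∀ b₁ b₂, ζ ≤ b₁ → 0 < b₁ → b₁ < b₂ → b₂ < 1 → h b₁ < h b₂)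
    (hν0 : 0 < ν) (hν1 : ν < 1) (hζν : ζ ≤ ν) (htan : g ν ≤ ν * h ν)
    (hb0 : 0 ≤ b) (hb1 : b < 1) : g ν + h ν * (b - ν) ≤ g b := by
  rcases hb0.eq_or_lt with rfl | hb0
  · linarith
  rcases lt_trichotomy b ν with hbν | rfl | hνb
  · obtain ⟨c, hbc, hcν, hc⟩ := exists_deriv_mul_sub_eq_sub hg hd hb0.le hbν hν1
    by_cases hle : h c ≤ h ν
    · nlinarith
    · have hcζ : c < ζ := by
        by_contra! hζc
        exact hle (hmono c ν hζc (hb0.trans hbc) hcν hν1).le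
      obtain ⟨d, hd0, hdb, hdg⟩ := exists_deriv_mul_sub_eq_sub hg hd le_rfl hb0 hb1
      have hcd := hanti d c hd0 (hdb.trans hbc).le hcζ.le
      nlinarith
  · simp
  · obtain ⟨c, hνc, hcb, hc⟩ := exists_deriv_mul_sub_eq_sub hg hd hν0.le hνb hb1
    have := hmono ν c hζν hν0 hνc (hcb.trans hb1)
    nlinarith

/-- The pointwise HJB inequality for the self-exciting-volume problem:
`a·(1 − e^{−ĥ(ν̂)y}) + (1+a)·(μ − ĝ(a/(1+a)))·(1 − e^{−ĥ(ν̂)y})/ĥ(ν̂) ≤ 0`. -/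
theorem vwap_hat_hjb_inequality
(gh hh : ℝ → ℝ) (ζ₀ μ : ℝ)
    (hg_cont : ContinuousOn gh (Set.Ico 0 1))
    (hg0 : gh 0 = 0)
    (hg_nonneg : ∀ b, 0 ≤ b → b < 1 → 0 ≤ gh b)
    (hg_deriv : ∀ b, 0 < b → b < 1 → HasDerivAt gh (hh b) b)
    (hh_cont : ContinuousOn hh (Set.Ioo 0 1))
    (hh_nonneg : ∀ b, 0 < b → b < 1 → 0 ≤ hh b)
    (hζ₀ : 0 ≤ ζ₀) (hζ₀1 : ζ₀ < 1)
    (hh_anti : ∀ b₁ b₂, 0 < b₁ → b₁ ≤ b₂ → b₂ ≤ ζ₀ → hh b₂ ≤ hh b₁)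
    (hh_mono : ∀ b₁ b₂, ζ₀ ≤ b₁ → 0 < b₁ → b₁ < b₂ → b₂ < 1 → hh b₁ < hh b₂)
    (hh_tendsto : Filter.Tendsto hh (nhdsWithin 1 (Set.Iio 1)) Filter.atTop)
    (hμ : μ < 0)
(νh : ℝ) (hνh_pos : 0 < νh) (hνh_lt : νh < 1) (hνh_ge : ζ₀ ≤ νh)
    (hνh_eq : νh * hh νh - gh νh = -μ) (hhνh_pos : 0 < hh νh) :
    ∀ a, 0 ≤ a → ∀ y, 0 ≤ y →
      a * (1 - Real.exp (-(hh νh) * y)) +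
        (1 + a) * (μ - gh (a / (1 + a))) *
          ((1 - Real.exp (-(hh νh) * y)) / hh νh) ≤ 0 := by
  intro a ha y hy
  have h1a : 0 < 1 + a := by linarith
  have htan := tangent_le_of_antitone_then_monotone_s16 hg_cont hg0 hg_deriv hh_anti hh_mono
    hνh_pos hνh_lt hνh_ge (by linarith) (div_nonneg ha h1a.le)
    ((div_lt_one h1a).2 (by linarith))
  have hexp : 0 ≤ 1 - Real.exp (-(hh νh) * y) :=
    sub_nonneg.2 (Real.exp_le_one_iff.2 (by nlinarith))
  have hfactor : a * (1 - Real.exp (-(hh νh) * y)) +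
      (1 + a) * (μ - gh (a / (1 + a))) * ((1 - Real.exp (-(hh νh) * y)) / hh νh) =
      (1 + a) * ((1 - Real.exp (-(hh νh) * y)) / hh νh) *
        (hh νh * (a / (1 + a)) + μ - gh (a / (1 + a))) := by
    generalize gh (a / (1 + a)) = G
    field_simp
    ring
  rw [hfactor]
  exact mul_nonpos_of_nonneg_of_nonpos (by positivity) (by linarith)
end

section
/- Let θ > 0 and 0 ≤ x ≤ ν·θ, and define a* : [0,θ] → [0,∞) by a*(τ) = ν for τ ∈ [0, x/ν] and a*(τ) = 0 for τ ∈ (x/ν, θ]. Then ∫₀^θ a*(s) ds = x and ∫₀^θ a*(τ)·exp(∫₀^τ (1 + a*(s))·(μ − ĝ(a*(s)/(1+a*(s)))) ds) dτ = (1 − e^{−ĥ(ν̂)·x})/ĥ(ν̂). -/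
/-- Restricting an interval integrand to `s ≤ T` truncates the interval at `T`. -/
theorem intervalIntegral_ite_le {T θ : ℝ} (hT0 : 0 ≤ T) (hTθ : T ≤ θ) (f : ℝ → ℝ) :
    (∫ s in (0:ℝ)..θ, if s ≤ T then f s else 0) = ∫ s in (0:ℝ)..T, f s := by
  simpa only [Set.indicator_apply, Set.mem_ofPred_eq] using
    intervalIntegral.integral_indicator (f := f) (μ := MeasureTheory.volume)
      (show T ∈ Set.Icc 0 θ from ⟨hT0, hTθ⟩)

/-- The integral of an exponentially decaying constant rate. -/
theorem integral_mul_exp_neg_mul {h : ℝ} (hh : h ≠ 0) (ν T : ℝ) :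
    (∫ τ in (0:ℝ)..T, ν * Real.exp (-h * (ν * τ))) =
      (1 - Real.exp (-h * (ν * T))) / h := by
  have hderiv : ∀ τ ∈ Set.uIcc 0 T,
      HasDerivAt (fun τ => -Real.exp (-h * (ν * τ)) / h) (ν * Real.exp (-h * (ν * τ))) τ := by
    intro τ _
    have hlin : HasDerivAt (fun τ : ℝ => -h * (ν * τ)) (-h * (ν * 1)) τ :=
      ((hasDerivAt_id τ).const_mul ν).const_mul (-h)
    refine (hlin.exp.neg.div_const h).congr_deriv ?_
    field_simp
  rw [intervalIntegral.integral_eq_sub_of_hasDerivAt hderiv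
    (Continuous.intervalIntegrable (by fun_prop) _ _)]
  simp only [mul_zero, Real.exp_zero]
  ring

/-- In the self-exciting-volume problem, the VWAP strategy
`a*(τ) = ν·1_{[0,x/ν]}(τ)` with `ν = ν̂/(1−ν̂)` liquidates exactly `x` and
achieves the value `(1 − e^{−ĥ(ν̂)x})/ĥ(ν̂)`. -/
theorem vwap_hat_strategy_attains
(gh hh : ℝ → ℝ) (ζ₀ μ : ℝ)
    (hg_cont : ContinuousOn gh (Set.Ico 0 1))
    (hg0 : gh 0 = 0)
    (hg_nonneg : ∀ b, 0 ≤ b → b < 1 → 0 ≤ gh b)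
    (hg_deriv : ∀ b, 0 < b → b < 1 → HasDerivAt gh (hh b) b)
    (hh_cont : ContinuousOn hh (Set.Ioo 0 1))
    (hh_nonneg : ∀ b, 0 < b → b < 1 → 0 ≤ hh b)
    (hζ₀ : 0 ≤ ζ₀) (hζ₀1 : ζ₀ < 1)
    (hh_anti : ∀ b₁ b₂, 0 < b₁ → b₁ ≤ b₂ → b₂ ≤ ζ₀ → hh b₂ ≤ hh b₁)
    (hh_mono : ∀ b₁ b₂, ζ₀ ≤ b₁ → 0 < b₁ → b₁ < b₂ → b₂ < 1 → hh b₁ < hh b₂)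
    (hh_tendsto : Filter.Tendsto hh (nhdsWithin 1 (Set.Iio 1)) Filter.atTop)
    (hμ : μ < 0)
(νh : ℝ) (hνh_pos : 0 < νh) (hνh_lt : νh < 1) (hνh_ge : ζ₀ ≤ νh)
    (hνh_eq : νh * hh νh - gh νh = -μ) (hhνh_pos : 0 < hh νh)
    (θ x : ℝ) (hθ : 0 < θ) (hx0 : 0 ≤ x) (hx : x ≤ νh / (1 - νh) * θ) :
    (∫ s in (0:ℝ)..θ, (if s ≤ x / (νh / (1 - νh)) then νh / (1 - νh) else 0)) = x ∧
    (∫ τ in (0:ℝ)..θ, (if τ ≤ x / (νh / (1 - νh)) then νh / (1 - νh) else 0) *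
        Real.exp (∫ s in (0:ℝ)..τ,
          (1 + (if s ≤ x / (νh / (1 - νh)) then νh / (1 - νh) else 0)) *
            (μ - gh ((if s ≤ x / (νh / (1 - νh)) then νh / (1 - νh) else 0) /
              (1 + (if s ≤ x / (νh / (1 - νh)) then νh / (1 - νh) else 0)))))) =
      (1 - Real.exp (-(hh νh) * x)) / hh νh := by
  have h1ν : 0 < 1 - νh := sub_pos.2 hνh_lt
  have hratio : νh / (1 - νh) / (1 + νh / (1 - νh)) = νh := by
    have hsum : 1 + νh / (1 - νh) = 1 / (1 - νh) := by field_simp; ring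
    rw [hsum]
    field_simp
  have hν : 0 < νh / (1 - νh) := div_pos hνh_pos h1ν
  have hrate : (1 + νh / (1 - νh)) * (μ - gh νh) = -hh νh * (νh / (1 - νh)) := by
    have hsub : μ - gh νh = -(νh * hh νh) := by linarith
    rw [hsub]
    field_simp
    ring
  set ν := νh / (1 - νh)
  have hT0 : 0 ≤ x / ν := div_nonneg hx0 hν.le
  have hTθ : x / ν ≤ θ := by rwa [div_le_iff₀' hν]
  have hνT : ν * (x / ν) = x := mul_div_cancel₀ x hν.ne'
  refine ⟨?_, ?_⟩
  · rw [intervalIntegral_ite_le hT0 hTθ fun _ => ν, intervalIntegral.integral_const, sub_zero,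
      smul_eq_mul, mul_comm, hνT]
  · simp only [ite_mul, zero_mul]
    rw [intervalIntegral_ite_le hT0 hTθ]
    conv_rhs => rw [← hνT]
    rw [← integral_mul_exp_neg_mul hhνh_pos.ne']
    refine intervalIntegral.integral_congr fun τ hτ => ?_
    rw [Set.uIcc_of_le hT0] at hτ
    have hexponent : (∫ s in (0:ℝ)..τ, (1 + (if s ≤ x / ν then ν else 0)) *
        (μ - gh ((if s ≤ x / ν then ν else 0) / (1 + (if s ≤ x / ν then ν else 0))))) =
        ∫ _ in (0:ℝ)..τ, -hh νh * ν := by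
      refine intervalIntegral.integral_congr fun s hs => ?_
      rw [Set.uIcc_of_le hτ.1] at hs
      simp only [if_pos (hs.2.trans hτ.2), hratio, hrate]
    simp only [hexponent, intervalIntegral.integral_const, smul_eq_mul, sub_zero]
    congr 2
    ring
end

section
/- (Deterministic reduction of Theorem 2.) Let θ > 0 and 0 ≤ x ≤ ν·θ. Then the supremum, over all bounded Lebesgue measurable a : [0,θ] → [0,∞) with ∫₀^θ a(s) ds ≤ x, of ∫₀^θ a(τ)·exp(∫₀^τ (1 + a(s))·(μ − ĝ(a(s)/(1+a(s)))) ds) dτ equals (1 − e^{−ĥ(ν̂)·x})/ĥ(ν̂), and it is attained by the VWAP strategy a*(τ) = ν·1_{[0, x/ν]}(τ). -/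
/-- Postcomposition with a `C¹` function preserves absolute continuity. -/
theorem AbsolutelyContinuousOnInterval.contDiff_comp {F f : ℝ → ℝ} {a b : ℝ}
    (hF : ContDiff ℝ 1 F) (hf : AbsolutelyContinuousOnInterval f a b) :
    AbsolutelyContinuousOnInterval (fun t => F (f t)) a b := by
  obtain ⟨K, hK⟩ := (hF.locallyLipschitz.locallyLipschitzOn
    (s := Set.image f (Set.uIcc a b))).exists_lipschitzOnWith_of_compact
    (isCompact_uIcc.image_of_continuousOn hf.continuousOn)
  rw [absolutelyContinuousOnInterval_iff] at hf ⊢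
  intro ε hε
  obtain ⟨δ, hδ, H⟩ := hf (ε / (K + 1)) (by positivity)
  refine ⟨δ, hδ, fun E hE hEδ => ?_⟩
  have hsum := H E hE hEδ
  rw [lt_div_iff₀ (by positivity)] at hsum
  calc ∑ i ∈ Finset.range E.1, dist (F (f (E.2 i).1)) (F (f (E.2 i).2))
      ≤ ∑ i ∈ Finset.range E.1, K * dist (f (E.2 i).1) (f (E.2 i).2) :=
        Finset.sum_le_sum fun i hi => hK.dist_le_mul _ (Set.mem_image_of_mem f (hE.1 i hi).1)
          _ (Set.mem_image_of_mem f (hE.1 i hi).2)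
    _ ≤ (∑ i ∈ Finset.range E.1, dist (f (E.2 i).1) (f (E.2 i).2)) * (K + 1) := by
        rw [← Finset.mul_sum, mul_comm]
        gcongr
        simp
    _ < ε := hsum

/-- Explicit value of `∫ a(τ) exp(-h ∫₀^τ a) dτ` for an integrable rate `a`. -/
theorem integral_mul_exp_neg_mul_integral {a : ℝ → ℝ} {h θ : ℝ} (hh : h ≠ 0)
    (ha : IntervalIntegrable a MeasureTheory.volume 0 θ) :
    ∫ τ in (0:ℝ)..θ, a τ * Real.exp (-h * ∫ s in (0:ℝ)..τ, a s) =
      (1 - Real.exp (-h * ∫ s in (0:ℝ)..θ, a s)) / h := by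
  have hF : ContDiff ℝ 1 fun y : ℝ => -Real.exp (-h * y) / h := by fun_prop
  have hAC := (ha.absolutelyContinuousOnInterval_intervalIntegral
    Set.left_mem_uIcc).contDiff_comp hF
  have hFTC := hAC.integral_deriv_eq_sub
  have hderiv : ∀ᵐ τ, τ ∈ Set.uIoc 0 θ →
      a τ * Real.exp (-h * ∫ s in (0:ℝ)..τ, a s) =
        deriv (fun t => -Real.exp (-h * ∫ s in (0:ℝ)..t, a s) / h) τ := by
    filter_upwards [ha.ae_hasDerivAt_integral] with τ hτ hmem
    have hd := hτ (Set.uIoc_subset_uIcc hmem) 0 Set.left_mem_uIcc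
    refine (((hd.const_mul (-h)).exp.fun_neg.div_const h).congr_deriv ?_).deriv.symm
    field_simp
  rw [intervalIntegral.integral_congr_ae hderiv, hFTC, intervalIntegral.integral_same]
  simp only [mul_zero, Real.exp_zero]
  ring

/-- A continuous function of a measurable function with values in a compact set is integrable. -/
theorem ContinuousOn.intervalIntegrable_comp_of_mapsTo {G a : ℝ → ℝ} {K : Set ℝ} {u v : ℝ}
    (hK : IsCompact K) (hG : ContinuousOn G K) (ha : Measurable a)
    (hmaps : Set.MapsTo a (Set.uIcc u v) K) :
    IntervalIntegrable (fun s => G (a s)) MeasureTheory.volume u v := by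
  classical
  obtain ⟨B, hB⟩ := hK.exists_bound_of_continuousOn hG
  have hmeas : Measurable fun s => K.piecewise G 0 (a s) :=
    (hG.measurable_piecewise continuousOn_const hK.measurableSet).comp ha
  rw [intervalIntegrable_iff]
  have hsub : Set.uIoc u v ⊆ Set.uIcc u v := Set.uIoc_subset_uIcc
  have hae : MeasureTheory.AEStronglyMeasurable (fun s => G (a s))
      (MeasureTheory.volume.restrict (Set.uIoc u v)) := by
    refine hmeas.aestronglyMeasurable.congr ?_
    filter_upwards [MeasureTheory.ae_restrict_mem measurableSet_uIoc] with s hs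
    exact Set.piecewise_eq_of_mem _ _ _ (hmaps (hsub hs))
  refine .of_bound (by simp) hae B ?_
  filter_upwards [MeasureTheory.ae_restrict_mem measurableSet_uIoc] with s hs
  exact hB _ (hmaps (hsub hs))

/-- If `G v ≤ -h v` for `v ≥ 0`, discounting at rate `G (a)` yields at most discounting
at rate `-h a`. -/
theorem integral_mul_exp_integral_le {G a : ℝ → ℝ} {h θ x : ℝ} (hh : 0 < h) (hθ : 0 ≤ θ)
    (hG : ∀ v, 0 ≤ v → G v ≤ -h * v) (ha0 : ∀ s ∈ Set.Icc 0 θ, 0 ≤ a s)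
    (ha : IntervalIntegrable a MeasureTheory.volume 0 θ)
    (hGa : IntervalIntegrable (fun s => G (a s)) MeasureTheory.volume 0 θ)
    (hx : (∫ s in (0:ℝ)..θ, a s) ≤ x) :
    ∫ τ in (0:ℝ)..θ, a τ * Real.exp (∫ s in (0:ℝ)..τ, G (a s)) ≤
      (1 - Real.exp (-h * x)) / h := by
  calc ∫ τ in (0:ℝ)..θ, a τ * Real.exp (∫ s in (0:ℝ)..τ, G (a s))
      ≤ ∫ τ in (0:ℝ)..θ, a τ * Real.exp (-h * ∫ s in (0:ℝ)..τ, a s) := by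
        have hprim {f : ℝ → ℝ} (hf : IntervalIntegrable f MeasureTheory.volume 0 θ) :
            ContinuousOn (fun τ => ∫ s in (0:ℝ)..τ, f s) (Set.uIcc 0 θ) :=
          (hf.absolutelyContinuousOnInterval_intervalIntegral Set.left_mem_uIcc).continuousOn
        refine intervalIntegral.integral_mono_on hθ (ha.mul_continuousOn (hprim hGa).rexp)
          (ha.mul_continuousOn (continuousOn_const.mul (hprim ha)).rexp) fun τ hτ => ?_
        have hsub : Set.uIcc 0 τ ⊆ Set.uIcc 0 θ := by
          rw [Set.uIcc_of_le hτ.1, Set.uIcc_of_le hθ]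
          exact Set.Icc_subset_Icc_right hτ.2
        refine mul_le_mul_of_nonneg_left (Real.exp_le_exp.2 ?_) (ha0 τ hτ)
        rw [← intervalIntegral.integral_const_mul]
        exact intervalIntegral.integral_mono_on hτ.1 (hGa.mono_set hsub)
          ((ha.mono_set hsub).const_mul _)
          fun s hs => hG _ (ha0 s ⟨hs.1, hs.2.trans hτ.2⟩)
    _ = (1 - Real.exp (-h * ∫ s in (0:ℝ)..θ, a s)) / h :=
        integral_mul_exp_neg_mul_integral hh.ne' ha
    _ ≤ (1 - Real.exp (-h * x)) / h := by
        have : -h * x ≤ -h * ∫ s in (0:ℝ)..θ, a s := by nlinarith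
        gcongr

/-- The tangent line to `g` at `ν`, lying strictly below `g` at `0`, lies below `g` on `[0,1)`
when `g` is concave and then convex, `ν` being in the convexity region. -/
theorem tangent_le_of_concave_convex {g h : ℝ → ℝ} {ζ μ ν : ℝ}
    (hg_cont : ContinuousOn g (Set.Ico 0 1)) (hg0 : g 0 = 0)
    (hg_deriv : ∀ b, 0 < b → b < 1 → HasDerivAt g (h b) b)
    (hζ : 0 ≤ ζ)
    (h_anti : ∀ b₁ b₂, 0 < b₁ → b₁ ≤ b₂ → b₂ ≤ ζ → h b₂ ≤ h b₁)
    (h_mono : ∀ b₁ b₂, ζ ≤ b₁ → 0 < b₁ → b₁ < b₂ → b₂ < 1 → h b₁ < h b₂)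
    (hμ : μ < 0) (hν_pos : 0 < ν) (hν_lt : ν < 1) (hν_ge : ζ ≤ ν)
    (hν_eq : ν * h ν - g ν = -μ) {b : ℝ} (hb0 : 0 ≤ b) (hb1 : b < 1) :
    μ - g b ≤ -h ν * b := by
  have hmvt : ∀ u v, 0 ≤ u → u < v → v < 1 → ∃ c, u < c ∧ c < v ∧ g v - g u = h c * (v - u) := by
    intro u v hu huv hv
    obtain ⟨c, hc, hslope⟩ := exists_hasDerivAt_eq_slope g h huv
      (hg_cont.mono fun y hy => ⟨hu.trans hy.1, hy.2.trans_lt hv⟩)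
      fun y hy => hg_deriv y (hu.trans_lt hy.1) (hy.2.trans hv)
    refine ⟨c, hc.1, hc.2, ?_⟩
    rw [hslope, div_mul_cancel₀ _ (sub_pos.2 huv).ne']
  have hconvex : ∀ b, ζ ≤ b → b < 1 → μ - g b ≤ -h ν * b := by
    intro b hζb hb1
    rcases lt_trichotomy b ν with hlt | rfl | hgt
    · obtain ⟨c, hbc, hcν, hc⟩ := hmvt b ν (hζ.trans hζb) hlt hν_lt
      have := h_mono c ν (hζb.trans hbc.le) ((hζ.trans hζb).trans_lt hbc) hcν hν_lt
      nlinarith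
    · linarith
    · obtain ⟨c, hνc, hcb, hc⟩ := hmvt ν b hν_pos.le hgt hb1
      have := h_mono ν c hν_ge hν_pos hνc (hcb.trans hb1)
      nlinarith
  rcases le_or_gt ζ b with hζb | hbζ
  · exact hconvex b hζb hb1
  rcases hb0.eq_or_lt with rfl | hb_pos
  · simpa [hg0] using hμ.le
  have hζ1 : ζ < 1 := hν_ge.trans_lt hν_lt
  obtain ⟨c₁, hc₁_pos, hc₁b, hc₁⟩ := hmvt 0 b le_rfl hb_pos hb1
  obtain ⟨c₂, hbc₂, hc₂ζ, hc₂⟩ := hmvt b ζ hb0 hbζ hζ1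
  have hc := h_anti c₁ c₂ hc₁_pos (hc₁b.trans hbc₂).le hc₂ζ.le
  have hat_ζ := hconvex ζ le_rfl hζ1
  rcases le_total (h c₂) (h ν) with hle | hge
  · nlinarith
  · rw [hg0] at hc₁
    nlinarith

/-- Deterministic reduction of Theorem 2: in the self-exciting-volume problem
the supremum of the proceeds over all admissible strategies equals
`(1 − e^{−ĥ(ν̂)x})/ĥ(ν̂)`, attained by the VWAP strategy
`a*(τ) = ν·1_{[0,x/ν]}(τ)` with `ν = ν̂/(1−ν̂)`. -/
theorem vwap_theorem_two
(gh hh : ℝ → ℝ) (ζ₀ μ : ℝ)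
    (hg_cont : ContinuousOn gh (Set.Ico 0 1))
    (hg0 : gh 0 = 0)
    (hg_nonneg : ∀ b, 0 ≤ b → b < 1 → 0 ≤ gh b)
    (hg_deriv : ∀ b, 0 < b → b < 1 → HasDerivAt gh (hh b) b)
    (hh_cont : ContinuousOn hh (Set.Ioo 0 1))
    (hh_nonneg : ∀ b, 0 < b → b < 1 → 0 ≤ hh b)
    (hζ₀ : 0 ≤ ζ₀) (hζ₀1 : ζ₀ < 1)
    (hh_anti : ∀ b₁ b₂, 0 < b₁ → b₁ ≤ b₂ → b₂ ≤ ζ₀ → hh b₂ ≤ hh b₁)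
    (hh_mono : ∀ b₁ b₂, ζ₀ ≤ b₁ → 0 < b₁ → b₁ < b₂ → b₂ < 1 → hh b₁ < hh b₂)
    (hh_tendsto : Filter.Tendsto hh (nhdsWithin 1 (Set.Iio 1)) Filter.atTop)
    (hμ : μ < 0)
(νh : ℝ) (hνh_pos : 0 < νh) (hνh_lt : νh < 1) (hνh_ge : ζ₀ ≤ νh)
    (hνh_eq : νh * hh νh - gh νh = -μ) (hhνh_pos : 0 < hh νh)
    (θ x : ℝ) (hθ : 0 < θ) (hx0 : 0 ≤ x) (hx : x ≤ νh / (1 - νh) * θ) :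
    IsGreatest {r : ℝ | ∃ a : ℝ → ℝ, Measurable a ∧
        (∃ C, ∀ s ∈ Set.Icc 0 θ, a s ≤ C) ∧
        (∀ s ∈ Set.Icc 0 θ, 0 ≤ a s) ∧
        (∫ s in (0:ℝ)..θ, a s) ≤ x ∧
        r = ∫ τ in (0:ℝ)..θ, a τ *
          Real.exp (∫ s in (0:ℝ)..τ, (1 + a s) * (μ - gh (a s / (1 + a s))))}
      ((1 - Real.exp (-(hh νh) * x)) / hh νh) ∧
    (∫ τ in (0:ℝ)..θ, (if τ ≤ x / (νh / (1 - νh)) then νh / (1 - νh) else 0) *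
        Real.exp (∫ s in (0:ℝ)..τ,
          (1 + (if s ≤ x / (νh / (1 - νh)) then νh / (1 - νh) else 0)) *
            (μ - gh ((if s ≤ x / (νh / (1 - νh)) then νh / (1 - νh) else 0) /
              (1 + (if s ≤ x / (νh / (1 - νh)) then νh / (1 - νh) else 0)))))) =
      (1 - Real.exp (-(hh νh) * x)) / hh νh := by
  set h := hh νh
  set ν := νh / (1 - νh) with hν_def
  have hsub_pos : 0 < 1 - νh := sub_pos.2 hνh_lt
  have hν_pos : 0 < ν := div_pos hνh_pos hsub_pos
  have hmaps : ∀ v : ℝ, 0 ≤ v → v / (1 + v) ∈ Set.Ico (0:ℝ) 1 := fun v hv =>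
    ⟨by positivity, (div_lt_one (by positivity)).2 (by linarith)⟩
  have hrate : ∀ v : ℝ, 0 ≤ v → (1 + v) * (μ - gh (v / (1 + v))) ≤ -h * v := by
    intro v hv
    have htangent := tangent_le_of_concave_convex hg_cont hg0 hg_deriv hζ₀ hh_anti hh_mono hμ
      hνh_pos hνh_lt hνh_ge hνh_eq (hmaps v hv).1 (hmaps v hv).2
    calc (1 + v) * (μ - gh (v / (1 + v))) ≤ (1 + v) * (-h * (v / (1 + v))) := by gcongr
      _ = -h * v := by field_simp
  have hrate_ν : (1 + ν) * (μ - gh (ν / (1 + ν))) = -h * ν := by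
    have hone : 1 + ν = 1 / (1 - νh) := by rw [hν_def]; field_simp; ring
    have hinv : ν / (1 + ν) = νh := by rw [hone, hν_def]; field_simp
    rw [hinv, hone, hν_def, show μ - gh νh = -h * νh by linarith]
    ring
  have hrate_cont (C : ℝ) :
      ContinuousOn (fun v : ℝ => (1 + v) * (μ - gh (v / (1 + v)))) (Set.Icc 0 C) := by
    have hquot : ContinuousOn (fun v : ℝ => v / (1 + v)) (Set.Icc 0 C) :=
      continuousOn_id.div (by fun_prop) fun v hv => by linarith [hv.1]
    exact (by fun_prop : ContinuousOn (fun v : ℝ => 1 + v) (Set.Icc 0 C)).mul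
      (continuousOn_const.sub (hg_cont.comp hquot fun v hv => hmaps v hv.1))
  set T := x / ν with hT_def
  have hT0 : 0 ≤ T := div_nonneg hx0 hν_pos.le
  have hTθ : T ≤ θ := (div_le_iff₀ hν_pos).2 (by linarith)
  have hvwap_meas : Measurable fun s : ℝ => if s ≤ T then ν else 0 :=
    Measurable.ite measurableSet_Iic measurable_const measurable_const
  have hvwap_int (u v : ℝ) :
      IntervalIntegrable (fun s : ℝ => if s ≤ T then ν else 0) MeasureTheory.volume u v := by
    refine ContinuousOn.intervalIntegrable_comp_of_mapsTo (G := id) (K := Set.Icc 0 ν)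
      (a := fun s => if s ≤ T then ν else 0) isCompact_Icc continuousOn_id hvwap_meas fun s _ => ?_
    by_cases hs : s ≤ T <;> simp [hs, hν_pos.le]
  have hvwap_total : ∫ s in (0:ℝ)..θ, (if s ≤ T then ν else 0) = x := by
    rw [← intervalIntegral.integral_add_adjacent_intervals (hvwap_int 0 T) (hvwap_int T θ)]
    have hbefore : ∫ s in (0:ℝ)..T, (if s ≤ T then ν else 0) = ∫ _ in (0:ℝ)..T, ν := by
      refine intervalIntegral.integral_congr fun s hs => if_pos ?_
      rw [Set.uIcc_of_le hT0] at hs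
      exact hs.2
    have hafter : ∫ s in T..θ, (if s ≤ T then ν else 0) = ∫ _ in T..θ, (0:ℝ) := by
      refine intervalIntegral.integral_congr_ae (Filter.Eventually.of_forall fun s hs => if_neg ?_)
      rw [Set.uIoc_of_le hTθ] at hs
      exact hs.1.not_ge
    rw [hbefore, hafter, intervalIntegral.integral_const, intervalIntegral.integral_zero,
      hT_def]
    simp only [sub_zero, smul_eq_mul, add_zero]
    field_simp
  have hvwap_value : (∫ τ in (0:ℝ)..θ, (if τ ≤ T then ν else 0) *
      Real.exp (∫ s in (0:ℝ)..τ, (1 + (if s ≤ T then ν else 0)) *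
        (μ - gh ((if s ≤ T then ν else 0) / (1 + (if s ≤ T then ν else 0)))))) =
      (1 - Real.exp (-h * x)) / h := by
    have hvalue := integral_mul_exp_neg_mul_integral hhνh_pos.ne' (hvwap_int 0 θ)
    rw [hvwap_total] at hvalue
    rw [← hvalue]
    refine intervalIntegral.integral_congr fun τ hτ => ?_
    rw [Set.uIcc_of_le hθ.le] at hτ
    by_cases hτT : τ ≤ T
    · rw [← intervalIntegral.integral_const_mul]
      congr 2
      refine intervalIntegral.integral_congr fun s hs => ?_
      rw [Set.uIcc_of_le hτ.1] at hs
      simpa only [if_pos (hs.2.trans hτT)] using hrate_ν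
    · simp only [if_neg hτT, zero_mul]
  refine ⟨⟨⟨fun s => if s ≤ T then ν else 0, hvwap_meas, ⟨ν, fun s _ => ?_⟩, fun s _ => ?_,
    hvwap_total.le, hvwap_value.symm⟩, ?_⟩, hvwap_value⟩
  · dsimp only
    split_ifs <;> linarith
  · dsimp only
    split_ifs <;> linarith
  · rintro r ⟨a, ha_meas, ⟨C, haC⟩, ha0, hax, rfl⟩
    have hmaps_a : Set.MapsTo a (Set.uIcc 0 θ) (Set.Icc 0 C) := fun s hs => by
      rw [Set.uIcc_of_le hθ.le] at hs
      exact ⟨ha0 s hs, haC s hs⟩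
    exact integral_mul_exp_integral_le (G := fun v => (1 + v) * (μ - gh (v / (1 + v))))
      hhνh_pos hθ.le hrate ha0
      (ContinuousOn.intervalIntegrable_comp_of_mapsTo (G := id) isCompact_Icc continuousOn_id
        ha_meas hmaps_a)
      ((hrate_cont C).intervalIntegrable_comp_of_mapsTo isCompact_Icc ha_meas hmaps_a) hax
end
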